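/- Let f : ℝⁿ → ℝ ∪ {+∞} be a proper lower semicontinuous function with 0 ∈ ∂f(x̄), and assume f is both prox-regular and subdifferentially continuous at x̄ for 0. Then x̄ is a tilt-stable local minimizer of f if and only if the generalized Hessian ∂²f(x̄, 0) is positive-definite, in the sense that ⟨u*, u⟩ > 0 whenever u* ∈ ∂²f(x̄, 0)(u) and u ≠ 0. -/

import Mathlib

open Filter Metric Topology RealInnerProductSpace

noncomputable section

variable {X : Type*} [NormedAddCommGroup X] [InnerProductSpace ℝ X]

/-- The regular/Fréchet subdifferential of `f` at `x`. -/
def FrechetSubdiff (f : X → EReal) (x : X) : Set X :=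
  {p | f x ≠ ⊤ ∧ ∀ ε : ℝ, 0 < ε → ∃ δ : ℝ, 0 < δ ∧
    ∀ y : X, ‖y - x‖ < δ → f x + ((⟪p, y - x⟫ - ε * ‖y - x‖ : ℝ) : EReal) ≤ f y}

/-- The limiting subdifferential of `f` at `x`: outer limit (in norm) of
Fréchet subdifferentials. -/
def LimitingSubdiff (f : X → EReal) (x : X) : Set X :=
  {p | ∃ (xs ps : ℕ → X),
    (∀ k, ps k ∈ FrechetSubdiff f (xs k)) ∧
    Tendsto xs atTop (𝓝 x) ∧
    Tendsto (fun k => f (xs k)) atTop (𝓝 (f x)) ∧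
    Tendsto ps atTop (𝓝 p)}

/-- `f` is subdifferentially continuous at `xb` for `pb`: the map `(x, p) ↦ f x` is
continuous at `(xb, pb)` relative to the graph of the limiting subdifferential. -/
def SubdiffContAt (f : X → EReal) (xb pb : X) : Prop :=
  Tendsto (fun q : X × X => f q.1)
    (𝓝[{q : X × X | q.2 ∈ LimitingSubdiff f q.1}] (xb, pb)) (𝓝 (f xb))

/-- `f` is prox-regular at `xb` for `pb`. -/
def ProxRegularAt (f : X → EReal) (xb pb : X) : Prop :=
  f xb ≠ ⊤ ∧ ∃ r : ℝ, 0 < r ∧ ∃ ε : ℝ, 0 < ε ∧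
    ∀ x ∈ Metric.closedBall xb ε, ∀ u ∈ Metric.closedBall xb ε,
      f u ≤ f xb + (ε : EReal) → f xb ≤ f u + (ε : EReal) →
      ∀ p ∈ LimitingSubdiff f u, p ∈ Metric.closedBall pb ε →
        f u + ((⟪p, x - u⟫ - r / 2 * ‖x - u‖ ^ 2 : ℝ) : EReal) ≤ f x

/-- The set of minimizers of the tilted function `x ↦ f x - ⟪p, x⟫` over the
closed ball of radius `γ` around `xb`. -/
def TiltArgmin (f : X → EReal) (xb : X) (γ : ℝ) (p : X) : Set X :=
  {x | x ∈ Metric.closedBall xb γ ∧ ∀ y ∈ Metric.closedBall xb γ,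
    f x - ((⟪p, x⟫ : ℝ) : EReal) ≤ f y - ((⟪p, y⟫ : ℝ) : EReal)}

/-- `xb` is a tilt-stable local minimizer of `f` with modulus `κ`. -/
def TiltStableWith (f : X → EReal) (xb : X) (κ : ℝ) : Prop :=
  ∃ γ : ℝ, 0 < γ ∧ ∃ V ∈ 𝓝 (0 : X), ∃ m : X → X,
    (∀ p ∈ V, TiltArgmin f xb γ p = {m p}) ∧
    LipschitzOnWith (Real.toNNReal κ) m V ∧ m 0 = xb

/-- `xb` is a tilt-stable local minimizer of `f`. -/
def TiltStable (f : X → EReal) (xb : X) : Prop :=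
  ∃ γ : ℝ, 0 < γ ∧ ∃ V ∈ 𝓝 (0 : X), ∃ m : X → X, ∃ K : NNReal,
    (∀ p ∈ V, TiltArgmin f xb γ p = {m p}) ∧
    LipschitzOnWith K m V ∧ m 0 = xb

/-- The Fréchet/regular normal cone to a subset of `X × X` at a point. -/
def FrechetNormalP (Ω : Set (X × X)) (zb : X × X) : Set (X × X) :=
  {w | ∀ ε : ℝ, 0 < ε → ∃ δ : ℝ, 0 < δ ∧ ∀ z ∈ Ω, dist z zb < δ →
    ⟪w.1, z.1 - zb.1⟫ + ⟪w.2, z.2 - zb.2⟫ ≤ ε * dist z zb}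

/-- The combined second-order subdifferential of `f` at `x` for `p ∈ ∂f(x)`:
the regular coderivative of the limiting subdifferential mapping. -/
def CombinedSecondSubdiff (f : X → EReal) (x p u : X) : Set X :=
  {w | (w, -u) ∈ FrechetNormalP {q : X × X | q.2 ∈ LimitingSubdiff f q.1} (x, p)}

/-- The limiting/Mordukhovich normal cone to a subset of `X × X` at a point. -/
def LimitingNormalP (Ω : Set (X × X)) (zb : X × X) : Set (X × X) :=
  {w | ∃ (zs ws : ℕ → X × X),
    (∀ k, zs k ∈ Ω ∧ ws k ∈ FrechetNormalP Ω (zs k)) ∧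
    Tendsto zs atTop (𝓝 zb) ∧ Tendsto ws atTop (𝓝 w)}

/-- The second-order subdifferential (generalized Hessian) of `f` at `xb` for
`pb ∈ ∂f(xb)`: the limiting coderivative of the limiting subdifferential mapping. -/
def SecondSubdiff (f : X → EReal) (xb pb u : X) : Set X :=
  {w | (w, -u) ∈ LimitingNormalP {q : X × X | q.2 ∈ LimitingSubdiff f q.1} (xb, pb)}

section Bridge
variable {E : Type*} [NormedAddCommGroup E] [InnerProductSpace ℝ E]

/-- The graph of the limiting subdifferential. -/
abbrev Gph (f : E → EReal) : Set (E × E) := {q : E × E | q.2 ∈ LimitingSubdiff f q.1}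

theorem frechet_sub_limiting (f : E → EReal) (x p : E) (h : p ∈ FrechetSubdiff f x) :
    p ∈ LimitingSubdiff f x :=
  ⟨fun _ => x, fun _ => p, fun _ => h, tendsto_const_nhds, tendsto_const_nhds, tendsto_const_nhds⟩

theorem br_H1 (f : E → EReal) (hbot : ∀ x, f x ≠ ⊥) (xb : E)
    (hpr : ProxRegularAt f xb 0) (hsc : SubdiffContAt f xb 0) :
    ∃ r : ℝ, 0 < r ∧ ∃ ε : ℝ, 0 < ε ∧ ∀ x p : E, (x, p) ∈ Gph f → ‖x - xb‖ ≤ ε → ‖p‖ ≤ ε →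
      f x ≠ ⊤ ∧ ∀ x', ‖x' - xb‖ ≤ ε → f x' ≠ ⊤ →
        (f x).toReal + ⟪p, x' - x⟫ - r / 2 * ‖x' - x‖ ^ 2 ≤ (f x').toReal := by
  obtain ⟨hxb, r, hr, ε, hε, H⟩ := hpr
  obtain ⟨a, ha⟩ : ∃ a : ℝ, f xb = a := ⟨_, (EReal.coe_toReal hxb (hbot xb)).symm⟩
  have h1 : ∀ᶠ q in 𝓝[Gph f] (xb, (0:E)), f q.1 ∈ Set.Ioo ((a - ε : ℝ) : EReal) ((a + ε : ℝ) : EReal) := by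
    apply hsc
    rw [ha]
    apply Ioo_mem_nhds <;> rw [EReal.coe_lt_coe_iff] <;> linarith
  rw [eventually_nhdsWithin_iff, Metric.eventually_nhds_iff] at h1
  obtain ⟨δ, hδ, h1⟩ := h1
  refine ⟨r, hr, min ε (δ / 2), by positivity, fun x p hG hx hp => ?_⟩
  have h2 := h1 (y := (x, p)) (by
    rw [Prod.dist_eq]
    simp only [dist_eq_norm, sub_zero]
    have := min_le_right ε (δ / 2)
    exact max_lt (by linarith) (by linarith)) hG
  have hxt : f x ≠ ⊤ := ne_top_of_lt h2.2
  refine ⟨hxt, fun x' hx' hx't => ?_⟩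
  have hm := min_le_left ε (δ / 2)
  obtain ⟨b, hb⟩ : ∃ a : ℝ, f x = a := ⟨_, (EReal.coe_toReal hxt (hbot x)).symm⟩
  obtain ⟨c, hc⟩ : ∃ a : ℝ, f x' = a := ⟨_, (EReal.coe_toReal hx't (hbot x')).symm⟩
  have h3 := H x' (by rw [mem_closedBall, dist_eq_norm]; linarith) x
    (by rw [mem_closedBall, dist_eq_norm]; linarith)
    (by
      rw [ha, ← EReal.coe_add]; exact h2.2.le)
    (by
      have := h2.1
      simp only [ha, hb] at *
      rw [← EReal.coe_add, EReal.coe_le_coe_iff]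
      rw [EReal.coe_lt_coe_iff] at this
      linarith) p hG (by rw [mem_closedBall, dist_eq_norm, sub_zero]; linarith)
  rw [hb, hc] at h3 ⊢
  rw [← EReal.coe_add, EReal.coe_le_coe_iff] at h3
  simp only [EReal.toReal_coe]
  linarith

theorem br_H2 (f : E → EReal) (hbot : ∀ x, f x ≠ ⊥) (x p : E) (hx : f x ≠ ⊤) (C δ : ℝ)
    (hδ : 0 < δ)
    (H : ∀ x', f x' ≠ ⊤ → ‖x' - x‖ < δ →
      (f x).toReal + ⟪p, x' - x⟫ - C * ‖x' - x‖ ^ 2 ≤ (f x').toReal) : (x, p) ∈ Gph f := by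
  apply frechet_sub_limiting
  refine ⟨hx, fun ε hε => ⟨min δ (ε / (|C| + 1)), by positivity, fun y hy => ?_⟩⟩
  by_cases hyt : f y = ⊤
  · rw [hyt]; exact le_top
  have h1 := H y hyt (lt_of_lt_of_le hy (min_le_left _ _))
  have h2 : ‖y - x‖ < ε / (|C| + 1) := (lt_of_lt_of_le hy (min_le_right _ _))
  rw [lt_div_iff₀ (by positivity)] at h2
  rw [← EReal.coe_toReal hx (hbot x), ← EReal.coe_toReal hyt (hbot y), ← EReal.coe_add,
    EReal.coe_le_coe_iff]
  have h3 : C * ‖y - x‖ ^ 2 ≤ ε * ‖y - x‖ := by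
    have := le_abs_self C
    have h0 := norm_nonneg (y - x)
    have : C * ‖y - x‖ ≤ ε := by nlinarith
    nlinarith
  linarith

theorem br_H3 [ProperSpace E] (f : E → EReal) (hbot : ∀ x, f x ≠ ⊥) (hlsc : LowerSemicontinuous f)
    (xb : E) (hxb : f xb ≠ ⊤) (γ : ℝ) (hγ : 0 ≤ γ) (φ : E → ℝ) (hφ : Continuous φ) :
    ∃ x, ‖x - xb‖ ≤ γ ∧ f x ≠ ⊤ ∧ ∀ x', ‖x' - xb‖ ≤ γ → f x' ≠ ⊤ →
      (f x).toReal + φ x ≤ (f x').toReal + φ x' := by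
  have hl : LowerSemicontinuous (fun x => f x + (φ x : EReal)) := by
    apply LowerSemicontinuous.add' hlsc (continuous_coe_real_ereal.comp hφ).lowerSemicontinuous
    intro x
    exact EReal.continuousAt_add (Or.inr (EReal.coe_ne_bot _)) (Or.inr (EReal.coe_ne_top _))
  obtain ⟨x, hx, hm⟩ := (hl.lowerSemicontinuousOn _).exists_isMinOn
    (s := closedBall xb γ) ⟨xb, mem_closedBall_self hγ⟩ (isCompact_closedBall xb γ)
  rw [isMinOn_iff] at hm
  have hxt : f x ≠ ⊤ := by
    intro h
    have := hm xb (mem_closedBall_self hγ)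
    rw [h, EReal.top_add_coe, top_le_iff] at this
    rw [← EReal.coe_toReal hxb (hbot xb), ← EReal.coe_add] at this
    exact EReal.coe_ne_top _ this
  refine ⟨x, by simpa [dist_eq_norm] using hx, hxt, fun x' hx' ht => ?_⟩
  have := hm x' (by simpa [dist_eq_norm] using hx')
  rw [← EReal.coe_toReal hxt (hbot x), ← EReal.coe_toReal ht (hbot x'), ← EReal.coe_add,
    ← EReal.coe_add, EReal.coe_le_coe_iff] at this
  exact this

theorem br_argmin (f : E → EReal) (hbot : ∀ x, f x ≠ ⊥) (xb : E) (hxb : f xb ≠ ⊤) (γ : ℝ)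
    (hγ : 0 ≤ γ) (p x : E) :
    x ∈ TiltArgmin f xb γ p ↔ ‖x - xb‖ ≤ γ ∧ f x ≠ ⊤ ∧ ∀ x', ‖x' - xb‖ ≤ γ → f x' ≠ ⊤ →
      (f x).toReal - ⟪p, x⟫ ≤ (f x').toReal - ⟪p, x'⟫ := by
  constructor
  · rintro ⟨h1, h2⟩
    have hxt : f x ≠ ⊤ := by
      intro h
      have := h2 xb (mem_closedBall_self hγ)
      rw [h, EReal.top_sub_coe, top_le_iff] at this
      rw [← EReal.coe_toReal hxb (hbot xb), ← EReal.coe_sub] at this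
      exact EReal.coe_ne_top _ this
    refine ⟨by simpa [dist_eq_norm] using h1, hxt, fun x' hx' ht => ?_⟩
    have := h2 x' (by simpa [dist_eq_norm] using hx')
    rw [← EReal.coe_toReal hxt (hbot x), ← EReal.coe_toReal ht (hbot x'), ← EReal.coe_sub,
      ← EReal.coe_sub, EReal.coe_le_coe_iff] at this
    exact this
  · rintro ⟨h1, hxt, h2⟩
    refine ⟨by simpa [dist_eq_norm] using h1, fun y hy => ?_⟩
    by_cases ht : f y = ⊤
    · rw [ht, EReal.top_sub_coe]; exact le_top
    rw [← EReal.coe_toReal hxt (hbot x), ← EReal.coe_toReal ht (hbot y), ← EReal.coe_sub,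
      ← EReal.coe_sub, EReal.coe_le_coe_iff]
    exact h2 y (by simpa [dist_eq_norm] using hy) ht

end Bridge
section Forward
variable {E : Type*} [NormedAddCommGroup E] [InnerProductSpace ℝ E]

theorem fwd_coco (D : Set E) (F : E → ℝ) (xb : E) (γ η K : ℝ) (hK : 0 < K) (m : E → E)
    (hm : ∀ p, ‖p‖ < η → ‖m p - xb‖ ≤ γ ∧ m p ∈ D ∧ ∀ x', ‖x' - xb‖ ≤ γ → x' ∈ D →
      F (m p) - ⟪p, m p⟫ ≤ F x' - ⟪p, x'⟫)
    (hL : ∀ p q, ‖p‖ < η → ‖q‖ < η → ‖m p - m q‖ ≤ K * ‖p - q‖) (p q : E)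
    (hp : ‖p‖ < η / 4) (hq : ‖q‖ < η / 4) :
    1 / (2 * K) * ‖m q - m p‖ ^ 2 ≤ ⟪q - p, m q - m p⟫ := by
  have hη : 0 < η := by have := norm_nonneg p; linarith
  have key : ∀ p q : E, ‖p‖ < η / 4 → ‖q‖ < η / 4 →
      F (m p) + ⟪p, m q - m p⟫ + 1 / (4 * K) * ‖m q - m p‖ ^ 2 ≤ F (m q) := by
    intro p q hp hq
    set d := m q - m p with hd
    set q' := p + (1 / (2 * K)) • d with hq'
    have e1 : ‖q' - p‖ = 1 / (2 * K) * ‖d‖ := by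
      rw [hq', add_sub_cancel_left, norm_smul, Real.norm_of_nonneg (by positivity)]
    have e2 : ‖d‖ ≤ K * ‖q - p‖ := hL q p (by linarith) (by linarith)
    have e3 : ‖q - p‖ ≤ ‖q‖ + ‖p‖ := norm_sub_le _ _
    have e4 : ‖q' - p‖ ≤ ‖q - p‖ := by
      rw [e1]
      calc 1 / (2 * K) * ‖d‖ ≤ 1 / (2 * K) * (K * ‖q - p‖) := by gcongr
        _ = ‖q - p‖ / 2 := by field_simp
        _ ≤ _ := by have := norm_nonneg (q - p); linarith
    have e5 : ‖q'‖ < η := by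
      have : ‖q'‖ ≤ ‖q' - p‖ + ‖p‖ := by simpa using norm_add_le (q' - p) p
      linarith
    have hp' : ‖p‖ < η := by linarith
    have hqq : ‖q‖ < η := by linarith
    have a1 := (hm q' e5).2.2 (m q) (hm q hqq).1 (hm q hqq).2.1
    have a2 := (hm p hp').2.2 (m q') (hm q' e5).1 (hm q' e5).2.1
    have a3 : ⟪q' - p, m q' - m p⟫ ≤ K * ‖q' - p‖ ^ 2 := by
      have b1 := real_inner_le_norm (q' - p) (m q' - m p)
      have b2 := hL q' p e5 hp'
      have := norm_nonneg (q' - p)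
      nlinarith
    have a4 : ⟪q' - p, d⟫ = 1 / (2 * K) * ‖d‖ ^ 2 := by
      rw [hq', add_sub_cancel_left, real_inner_smul_left, real_inner_self_eq_norm_sq]
    have a5 : K * ‖q' - p‖ ^ 2 = 1 / (4 * K) * ‖d‖ ^ 2 := by
      rw [e1]; field_simp; ring
    have a6 : 1 / (2 * K) * ‖d‖ ^ 2 = 1 / (4 * K) * ‖d‖ ^ 2 + 1 / (4 * K) * ‖d‖ ^ 2 := by
      field_simp; ring
    rw [hd] at a4 a5 a6 ⊢
    simp only [inner_sub_left, inner_sub_right] at *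
    linarith
  have k1 := key p q hp hq
  have k2 := key q p hq hp
  rw [norm_sub_rev (m p) (m q)] at k2
  have a6 : 1 / (2 * K) * ‖m q - m p‖ ^ 2 =
      1 / (4 * K) * ‖m q - m p‖ ^ 2 + 1 / (4 * K) * ‖m q - m p‖ ^ 2 := by
    field_simp; ring
  rw [a6]
  simp only [inner_sub_left, inner_sub_right] at *
  linarith

theorem fwd_surj [ProperSpace E] (η K s : ℝ) (hs : 0 < s) (m : E → E)
    (hmon : ∀ p q, ‖p‖ ≤ η → ‖q‖ ≤ η → 0 ≤ ⟪q - p, m q - m p⟫)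
    (hL : ∀ p q, ‖p‖ ≤ η → ‖q‖ ≤ η → ‖m p - m q‖ ≤ K * ‖p - q‖) (hK : 0 < K) (y : E)
    (hy : 3 * ‖y - s • m 0‖ ≤ η) : ∃ q, ‖q‖ ≤ η ∧ q + s • m q = y := by
  have hη : 0 ≤ η := by have := norm_nonneg (y - s • m 0); linarith
  have hmc : ContinuousOn m (closedBall 0 η) := by
    apply LipschitzOnWith.continuousOn (K := K.toNNReal)
    apply LipschitzOnWith.of_dist_le_mul
    intro p hp q hq
    rw [dist_eq_norm, dist_eq_norm, Real.coe_toNNReal _ hK.le]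
    exact hL p q (by simpa using hp) (by simpa using hq)
  have hc : ContinuousOn (fun q => ‖y - (q + s • m q)‖) (closedBall 0 η) := by fun_prop
  obtain ⟨q, hq, hmin⟩ := (isCompact_closedBall (0:E) η).exists_isMinOn
    ⟨0, mem_closedBall_self hη⟩ hc
  rw [isMinOn_iff] at hmin
  have hq' : ‖q‖ ≤ η := by simpa using hq
  have h0 := hmin 0 (mem_closedBall_self hη)
  simp only [zero_add] at h0
  set R := y - (q + s • m q) with hR
  set δ := ‖y - s • m 0‖ with hδ
  refine ⟨q, hq', ?_⟩
  by_contra hne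
  have hRpos : 0 < ‖R‖ := by
    rw [norm_pos_iff, hR, sub_ne_zero]; exact fun h => hne h.symm
  -- the minimizer is inside
  have hqn : ‖q‖ ≤ 2 * δ := by
    have h1 := hmon 0 q (by simpa using hη) hq'
    have h2 : q = (y - s • m 0) - R - s • (m q - m 0) := by rw [hR, smul_sub]; abel
    have h3 : ‖q‖ ^ 2 ≤ ‖q‖ * (2 * δ) := by
      have : ⟪q, q⟫ = ⟪q, (y - s • m 0) - R⟫ - s * ⟪q, m q - m 0⟫ := 
        (congrArg (inner ℝ q) h2).trans (by rw [inner_sub_right, real_inner_smul_right])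
      rw [real_inner_self_eq_norm_sq] at this
      have h4 := real_inner_le_norm q ((y - s • m 0) - R)
      have h5 := norm_sub_le (y - s • m 0) R
      rw [sub_zero] at h1
      have h6 := mul_nonneg hs.le h1
      have : ‖q‖ * ‖(y - s • m 0) - R‖ ≤ ‖q‖ * (2 * δ) := by
        gcongr; linarith
      linarith
    by_contra hcon
    push Not at hcon
    have : 0 < ‖q‖ := by
      have : 0 ≤ δ := norm_nonneg _
      linarith
    nlinarith
  set t := 1 / (1 + s ^ 2 * K ^ 2) with ht
  have htpos : 0 < t := by positivity
  have ht1 : t ≤ 1 := by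
    rw [ht, div_le_one (by positivity)]
    have : 0 ≤ s ^ 2 * K ^ 2 := by positivity
    linarith
  have htt : t * (1 + s ^ 2 * K ^ 2) = 1 := by rw [ht]; field_simp
  have hn : ‖q + t • R‖ ≤ η := by
    have := norm_add_le q (t • R)
    rw [norm_smul, Real.norm_of_nonneg htpos.le] at this
    nlinarith [norm_nonneg R]
  have h1 := hmin (q + t • R) (by simpa using hn)
  set Δ := m (q + t • R) - m q with hΔ
  have h2 : y - (q + t • R + s • m (q + t • R)) = (1 - t) • R - s • Δ := by
    rw [hΔ, hR]; module
  rw [h2] at h1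
  have h3 := hmon q (q + t • R) hq' hn
  have h4 := hL (q + t • R) q hn hq'
  rw [add_sub_cancel_left, ← hΔ, norm_smul, Real.norm_of_nonneg htpos.le] at h4
  rw [add_sub_cancel_left, ← hΔ, real_inner_smul_left] at h3
  have h3' : 0 ≤ ⟪R, Δ⟫ := by
    by_contra hcon; push Not at hcon; nlinarith
  have h5 : ‖R‖ ^ 2 ≤ ‖(1 - t) • R - s • Δ‖ ^ 2 := by gcongr
  rw [norm_sub_sq_real ((1 - t) • R) (s • Δ), norm_smul, norm_smul, Real.norm_of_nonneg hs.le,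
    Real.norm_of_nonneg (by linarith : 0 ≤ 1 - t), real_inner_smul_left, real_inner_smul_right] at h5
  have h6 : (s * ‖Δ‖) ^ 2 ≤ (s * (K * (t * ‖R‖))) ^ 2 := by gcongr
  have h7 : 0 ≤ 2 * ((1 - t) * (s * ⟪R, Δ⟫)) :=
    mul_nonneg (by norm_num) (mul_nonneg (by linarith) (mul_nonneg hs.le h3'))
  have h8 : ‖R‖ ^ 2 ≤ ((1 - t) ^ 2 + t ^ 2 * (s ^ 2 * K ^ 2)) * ‖R‖ ^ 2 := by nlinarith
  have h9 : (1 - t) ^ 2 + t ^ 2 * (s ^ 2 * K ^ 2) = 1 - t := by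
    have : (1 - t) ^ 2 + t ^ 2 * (s ^ 2 * K ^ 2) = 1 - 2 * t + t * (t * (1 + s ^ 2 * K ^ 2)) := by ring
    rw [this, htt]; ring
  rw [h9] at h8
  have : 0 < t * ‖R‖ ^ 2 := by positivity
  linarith

/-- Hypomonotonicity of the graph. -/
theorem hypo (D : Set E) (F : E → ℝ) (G : Set (E × E)) (xb : E) (r ε : ℝ)
    (H1 : ∀ x p : E, (x, p) ∈ G → ‖x - xb‖ ≤ ε → ‖p‖ ≤ ε →
      x ∈ D ∧ ∀ x', ‖x' - xb‖ ≤ ε → x' ∈ D →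
        F x + ⟪p, x' - x⟫ - r / 2 * ‖x' - x‖ ^ 2 ≤ F x')
    (x p x' p' : E) (h : (x, p) ∈ G) (h' : (x', p') ∈ G) (hx : ‖x - xb‖ ≤ ε) (hp : ‖p‖ ≤ ε)
    (hx' : ‖x' - xb‖ ≤ ε) (hp' : ‖p'‖ ≤ ε) : - r * ‖x - x'‖ ^ 2 ≤ ⟪p - p', x - x'⟫ := by
  have a := H1 x p h hx hp
  have b := H1 x' p' h' hx' hp'
  have a1 := a.2 x' hx' b.1
  have b1 := b.2 x hx a.1
  rw [norm_sub_rev x' x] at a1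
  simp only [inner_sub_left, inner_sub_right] at *
  linarith

theorem fwd_graph [ProperSpace E] (D : Set E) (F : E → ℝ) (G : Set (E × E)) (xb : E) (r ε : ℝ)
    (hr : 0 < r) (hε : 0 < ε)
    (H1 : ∀ x p : E, (x, p) ∈ G → ‖x - xb‖ ≤ ε → ‖p‖ ≤ ε →
      x ∈ D ∧ ∀ x', ‖x' - xb‖ ≤ ε → x' ∈ D →
        F x + ⟪p, x' - x⟫ - r / 2 * ‖x' - x‖ ^ 2 ≤ F x')
    (η K : ℝ) (hη : 0 < η) (hK : 0 < K) (hηε : η ≤ ε) (hKε : K * η ≤ ε) (m : E → E)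
    (hG : ∀ p, ‖p‖ ≤ η → (m p, p) ∈ G)
    (hmon : ∀ p q, ‖p‖ ≤ η → ‖q‖ ≤ η → 0 ≤ ⟪q - p, m q - m p⟫)
    (hL : ∀ p q, ‖p‖ ≤ η → ‖q‖ ≤ η → ‖m p - m q‖ ≤ K * ‖p - q‖) (hm0 : m 0 = xb) :
    ∃ δ, 0 < δ ∧ ∀ x p, (x, p) ∈ G → ‖x - xb‖ < δ → ‖p‖ < δ → x = m p := by
  set s := r + 1 with hs
  refine ⟨min ε (η / (3 * (1 + s))), by positivity, fun x p hxp hx hp => ?_⟩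
  have hx1 := lt_of_lt_of_le hx (min_le_left _ _)
  have hp1 := lt_of_lt_of_le hp (min_le_left _ _)
  have hx2 := lt_of_lt_of_le hx (min_le_right _ _)
  have hp2 := lt_of_lt_of_le hp (min_le_right _ _)
  have hs0 : 0 < s := by linarith
  obtain ⟨q, hq, e⟩ := fwd_surj η K s hs0 m hmon hL hK (p + s • x) (by
    rw [hm0]
    have : p + s • x - s • xb = p + s • (x - xb) := by module
    rw [this]
    have h1 := norm_add_le p (s • (x - xb))
    rw [norm_smul, Real.norm_of_nonneg hs0.le] at h1
    rw [lt_div_iff₀ (by positivity)] at hx2 hp2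
    nlinarith)
  have hmq : ‖m q - xb‖ ≤ ε := by
    have := hL q 0 hq (by simpa using hη.le)
    rw [hm0, sub_zero] at this
    nlinarith
  have h := hypo D F G xb r ε H1 x p (m q) q hxp (hG q hq) hx1.le hp1.le hmq (hq.trans hηε)
  have e2 : p - q = - (s • (x - m q)) := by
    rw [smul_sub, neg_sub, sub_eq_sub_iff_add_eq_add, ← e, add_comm]
  rw [e2, inner_neg_left, real_inner_smul_left, real_inner_self_eq_norm_sq] at h
  have h2 : ‖x - m q‖ ^ 2 ≤ 0 := by rw [hs] at h; nlinarith
  have h3 : x - m q = 0 := by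
    rw [← norm_eq_zero]; exact pow_eq_zero_iff two_ne_zero |>.1 (le_antisymm h2 (by positivity))
  have h4 : p = q := by
    rw [h3, smul_zero, neg_zero, sub_eq_zero] at e2; exact e2
  rw [h4]; exact sub_eq_zero.1 h3

theorem fwd_normal (G : Set (E × E)) (η K μ : ℝ) (hK : 0 < K) (hμ : 0 < μ) (m : E → E)
    (hG : ∀ p, ‖p‖ < η → (m p, p) ∈ G)
    (hco : ∀ p q, ‖p‖ < η → ‖q‖ < η → μ * ‖m q - m p‖ ^ 2 ≤ ⟪q - p, m q - m p⟫)
    (hL : ∀ p q, ‖p‖ < η → ‖q‖ < η → ‖m p - m q‖ ≤ K * ‖p - q‖) (p : E) (hp : ‖p‖ < η)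
    (w u : E) (h : (w, -u) ∈ FrechetNormalP G (m p, p)) : μ * ‖u‖ ^ 2 ≤ ⟪w, u⟫ := by
  set v := w - (2 * μ) • u with hv
  have main : ∀ e : ℝ, 0 < e → μ * ‖u‖ ^ 2 ≤ ⟪w, u⟫ + e * ((1 + K) * ‖v‖) := by
    intro e he
    obtain ⟨δ, hδ, hN⟩ := h e he
    obtain ⟨t, ht, ht1⟩ : ∃ t : ℝ, 0 < t ∧ t * ((1 + K) * ‖v‖ + 1) < min δ (η - ‖p‖) := by
      have : 0 < min δ (η - ‖p‖) := lt_min hδ (by linarith)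
      refine ⟨min δ (η - ‖p‖) / 2 / ((1 + K) * ‖v‖ + 1), by positivity, ?_⟩
      rw [div_mul_cancel₀ _ (by positivity)]; linarith
    have ht2 := lt_of_lt_of_le ht1 (min_le_left _ _)
    have ht3 := lt_of_lt_of_le ht1 (min_le_right _ _)
    have hv0 := norm_nonneg v
    have htv : 0 ≤ t * ‖v‖ := by positivity
    have hKtv : 0 ≤ K * (t * ‖v‖) := by positivity
    set q := p + t • v with hqd
    have hqp : q - p = t • v := by rw [hqd, add_sub_cancel_left]
    have hqpn : ‖q - p‖ = t * ‖v‖ := by rw [hqp, norm_smul, Real.norm_of_nonneg ht.le]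
    have hq : ‖q‖ < η := by
      have := norm_add_le p (t • v)
      rw [norm_smul, Real.norm_of_nonneg ht.le] at this
      nlinarith
    set Δ := m q - m p with hΔ
    have hLq := hL q p hq hp
    rw [← hΔ, hqpn] at hLq
    have hd : dist (m q, q) (m p, p) ≤ t * ((1 + K) * ‖v‖) := by
      rw [Prod.dist_eq]
      simp only [dist_eq_norm]
      rw [← hΔ, hqpn]
      apply max_le <;> nlinarith
    have h1 := hN (m q, q) (hG q hq) (by nlinarith)
    simp only [← hΔ, hqp] at h1
    rw [inner_neg_left, real_inner_smul_right] at h1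
    have h2 := hco p q hp hq
    rw [hqp, ← hΔ, real_inner_smul_left] at h2
    have h3 : ⟪v, Δ⟫ = ⟪w, Δ⟫ - 2 * μ * ⟪u, Δ⟫ := by
      rw [hv, inner_sub_left, real_inner_smul_left]
    have h4 : ⟪u, v⟫ = ⟪w, u⟫ - 2 * μ * ‖u‖ ^ 2 := by
      rw [hv, inner_sub_right, real_inner_smul_right, real_inner_self_eq_norm_sq, real_inner_comm]
    have h5 : 0 ≤ ‖Δ + (t) • u‖ ^ 2 := by positivity
    rw [norm_add_sq_real, real_inner_smul_right, norm_smul, Real.norm_of_nonneg ht.le,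
      real_inner_comm] at h5
    have h6 : e * dist (m q, q) (m p, p) ≤ e * (t * ((1 + K) * ‖v‖)) := by gcongr
    rw [h4] at h1
    rw [h3] at h2
    have h7 : t * (t * (μ * ‖u‖ ^ 2)) ≤ t * (t * (⟪w, u⟫ + e * ((1 + K) * ‖v‖))) := by
      nlinarith [mul_le_mul_of_nonneg_left (h1.trans h6) ht.le, mul_nonneg hμ.le h5]
    exact le_of_mul_le_mul_left (le_of_mul_le_mul_left h7 ht) ht
  by_contra hcon
  push Not at hcon
  have hpos : 0 < (μ * ‖u‖ ^ 2 - ⟪w, u⟫) / 2 / ((1 + K) * ‖v‖ + 1) := by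
    have : 0 ≤ (1 + K) * ‖v‖ := by positivity
    apply div_pos <;> linarith
  have h1 := main _ hpos
  have h2 : (μ * ‖u‖ ^ 2 - ⟪w, u⟫) / 2 / ((1 + K) * ‖v‖ + 1) * ((1 + K) * ‖v‖ + 1) =
    (μ * ‖u‖ ^ 2 - ⟪w, u⟫) / 2 := by
    rw [div_mul_cancel₀]; positivity
  linarith

theorem fwd [ProperSpace E] (D : Set E) (F : E → ℝ) (G : Set (E × E)) (xb : E) (r ε : ℝ)
    (hr : 0 < r) (hε : 0 < ε)
    (H1 : ∀ x p : E, (x, p) ∈ G → ‖x - xb‖ ≤ ε → ‖p‖ ≤ ε →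
      x ∈ D ∧ ∀ x', ‖x' - xb‖ ≤ ε → x' ∈ D →
        F x + ⟪p, x' - x⟫ - r / 2 * ‖x' - x‖ ^ 2 ≤ F x')
    (H2 : ∀ x p : E, x ∈ D → ∀ C δ : ℝ, 0 < δ → (∀ x', x' ∈ D → ‖x' - x‖ < δ →
      F x + ⟪p, x' - x⟫ - C * ‖x' - x‖ ^ 2 ≤ F x') → (x, p) ∈ G)
    (γ η K : ℝ) (hγ : 0 < γ) (hη : 0 < η) (hK : 0 < K) (m : E → E)
    (hm : ∀ p, ‖p‖ < η → ‖m p - xb‖ ≤ γ ∧ m p ∈ D ∧ ∀ x', ‖x' - xb‖ ≤ γ → x' ∈ D →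
      F (m p) - ⟪p, m p⟫ ≤ F x' - ⟪p, x'⟫)
    (hL : ∀ p q, ‖p‖ < η → ‖q‖ < η → ‖m p - m q‖ ≤ K * ‖p - q‖) (hm0 : m 0 = xb) (u w : E)
    (h : (w, -u) ∈ LimitingNormalP G (xb, 0)) (hu : u ≠ 0) : 0 < ⟪w, u⟫ := by
  obtain ⟨ρ, hρ, hρ1, hρ2, hρ3, hρ4⟩ : ∃ ρ : ℝ, 0 < ρ ∧ ρ < η / 4 ∧ ρ ≤ ε ∧ K * ρ ≤ ε ∧ K * ρ < γ := by
    refine ⟨min (η / 8) (min ε (min (ε / K) (γ / (2 * K)))), by positivity, ?_, ?_, ?_, ?_⟩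
    · exact lt_of_le_of_lt (min_le_left _ _) (by linarith)
    · exact (min_le_right _ _).trans (min_le_left _ _)
    · have : min (η / 8) (min ε (min (ε / K) (γ / (2 * K)))) ≤ ε / K :=
        (min_le_right _ _).trans ((min_le_right _ _).trans (min_le_left _ _))
      rwa [le_div_iff₀ hK, mul_comm] at this
    · have : min (η / 8) (min ε (min (ε / K) (γ / (2 * K)))) ≤ γ / (2 * K) :=
        (min_le_right _ _).trans ((min_le_right _ _).trans (min_le_right _ _))
      rw [le_div_iff₀ (by positivity)] at this
      nlinarith
  have hco : ∀ p q, ‖p‖ ≤ ρ → ‖q‖ ≤ ρ → 1 / (2 * K) * ‖m q - m p‖ ^ 2 ≤ ⟪q - p, m q - m p⟫ :=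
    fun p q hp hq => fwd_coco D F xb γ η K hK m hm hL p q (by linarith) (by linarith)
  have hL' : ∀ p q, ‖p‖ ≤ ρ → ‖q‖ ≤ ρ → ‖m p - m q‖ ≤ K * ‖p - q‖ :=
    fun p q hp hq => hL p q (by linarith) (by linarith)
  have hG : ∀ p, ‖p‖ ≤ ρ → (m p, p) ∈ G := by
    intro p hp
    have h1 := hm p (by linarith)
    have h2 := hL' p 0 hp (by simpa using hρ.le)
    rw [hm0, sub_zero] at h2
    have h3 : ‖m p - xb‖ < γ := by nlinarith
    refine H2 _ _ h1.2.1 0 (γ - ‖m p - xb‖) (by linarith) fun x' hx' hd => ?_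
    have := h1.2.2 x' (by
      have : ‖x' - xb‖ ≤ ‖x' - m p‖ + ‖m p - xb‖ := by simpa using norm_add_le (x' - m p) (m p - xb)
      linarith) hx'
    rw [inner_sub_right]; linarith
  obtain ⟨δ, hδ, hgr⟩ := fwd_graph D F G xb r ε hr hε H1 ρ K hρ hK hρ2 hρ3 m hG
    (fun p q hp hq => le_trans (by positivity) (hco p q hp hq)) hL' hm0
  obtain ⟨zs, ws, hz, hzt, hwt⟩ := h
  have ev : ∀ᶠ k in atTop, 1 / (2 * K) * ‖-(ws k).2‖ ^ 2 ≤ ⟪(ws k).1, -(ws k).2⟫ := by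
    have h1 : ∀ᶠ k in atTop, dist (zs k) (xb, 0) < min δ ρ :=
      hzt (Metric.ball_mem_nhds _ (by positivity))
    filter_upwards [h1] with k hk
    rw [Prod.dist_eq] at hk
    simp only [dist_eq_norm, sub_zero] at hk
    have hk1 := lt_of_le_of_lt (le_max_left _ _) hk
    have hk2 := lt_of_le_of_lt (le_max_right _ _) hk
    have h2 := hgr (zs k).1 (zs k).2 (hz k).1 (lt_of_lt_of_le hk1 (min_le_left _ _))
      (lt_of_lt_of_le hk2 (min_le_left _ _))
    have h3 := (hz k).2
    refine fwd_normal G ρ K (1 / (2 * K)) hK (by positivity) m (fun p hp => hG p hp.le)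
      (fun p q hp hq => hco p q hp.le hq.le) (fun p q hp hq => hL' p q hp.le hq.le) (zs k).2
      (lt_of_lt_of_le hk2 (min_le_right _ _)) _ _ ?_
    rw [← h2, neg_neg]; exact h3
  have hw1 : Tendsto (fun k => (ws k).1) atTop (𝓝 w) := (continuous_fst.tendsto _).comp hwt
  have hw2 : Tendsto (fun k => -(ws k).2) atTop (𝓝 u) := by
    have := ((continuous_snd.tendsto _).comp hwt).neg
    simpa using this
  have := le_of_tendsto_of_tendsto ((hw2.norm.pow 2).const_mul (1 / (2 * K))) (hw1.inner hw2) ev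
  have h2 : 0 < 1 / (2 * K) * ‖u‖ ^ 2 := by positivity
  linarith
end Forward
section Backward
variable {E : Type*} [NormedAddCommGroup E] [InnerProductSpace ℝ E]

theorem bwd_P [ProperSpace E] (D : Set E) (F : E → ℝ) (G : Set (E × E)) (xb : E) (r ε : ℝ)
    (hr : 0 < r) (hε : 0 < ε) (h0 : (xb, 0) ∈ G)
    (H1 : ∀ x p : E, (x, p) ∈ G → ‖x - xb‖ ≤ ε → ‖p‖ ≤ ε →
      x ∈ D ∧ ∀ x', ‖x' - xb‖ ≤ ε → x' ∈ D →
        F x + ⟪p, x' - x⟫ - r / 2 * ‖x' - x‖ ^ 2 ≤ F x')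
    (H2 : ∀ x p : E, x ∈ D → ∀ C δ : ℝ, 0 < δ → (∀ x', x' ∈ D → ‖x' - x‖ < δ →
      F x + ⟪p, x' - x⟫ - C * ‖x' - x‖ ^ 2 ≤ F x') → (x, p) ∈ G)
    (H3 : ∀ γ : ℝ, 0 ≤ γ → ∀ φ : E → ℝ, Continuous φ → ∃ x, ‖x - xb‖ ≤ γ ∧ x ∈ D ∧
      ∀ x', ‖x' - xb‖ ≤ γ → x' ∈ D → F x + φ x ≤ F x' + φ x')
    (s : ℝ) (hs : s = r + 1) :
    ∃ ρ : ℝ, 0 < ρ ∧ ∃ P : E → E, P (s • xb) = xb ∧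
      (∀ y, ‖y - s • xb‖ ≤ ρ → (P y, y - s • P y) ∈ G ∧ P y ∈ D ∧ ∀ x', ‖x' - xb‖ ≤ ε → x' ∈ D →
        F (P y) + (s / 2 * ‖P y‖ ^ 2 - ⟪y, P y⟫) ≤ F x' + (s / 2 * ‖x'‖ ^ 2 - ⟪y, x'⟫)) ∧
      (∀ y y', ‖y - s • xb‖ ≤ ρ → ‖y' - s • xb‖ ≤ ρ → ‖P y - P y'‖ ≤ ‖y - y'‖) ∧
      (∀ x p, (x, p) ∈ G → ‖x - xb‖ < ρ → ‖p‖ < ρ → ‖p + s • x - s • xb‖ ≤ ρ →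
        x = P (p + s • x)) := by
  have hs0 : 0 < s := by linarith
  have ex : ∀ y : E, ∃ x, ‖x - xb‖ ≤ ε ∧ x ∈ D ∧ ∀ x', ‖x' - xb‖ ≤ ε → x' ∈ D →
      F x + (s / 2 * ‖x‖ ^ 2 - ⟪y, x⟫) ≤ F x' + (s / 2 * ‖x'‖ ^ 2 - ⟪y, x'⟫) :=
    fun y => H3 ε hε.le (fun x => s / 2 * ‖x‖ ^ 2 - ⟪y, x⟫) (by fun_prop)
  choose P hP1 hP2 hP3 using ex
  have hxb := H1 xb 0 h0 (by simpa using hε.le) (by simpa using hε.le)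
  have hdist : ∀ y, ‖P y - xb‖ ≤ 2 * ‖y - s • xb‖ := by
    intro y
    have a1 := hP3 y xb (by simpa using hε.le) hxb.1
    have a2 := hxb.2 (P y) (hP1 y) (hP2 y)
    have a3 : ‖P y - xb‖ ^ 2 ≤ 2 * ⟪y - s • xb, P y - xb⟫ := by
      rw [inner_zero_left] at a2
      rw [inner_sub_left, real_inner_smul_left, inner_sub_right, inner_sub_right,
        real_inner_self_eq_norm_sq]
      have e1 := norm_sub_sq_real (P y) xb
      rw [real_inner_comm] at e1
      subst hs
      rw [e1] at a2 ⊢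
      linarith
    have a4 := real_inner_le_norm (y - s • xb) (P y - xb)
    by_contra hcon
    push Not at hcon
    have : 0 < ‖P y - xb‖ := by have := norm_nonneg (y - s • xb); linarith
    nlinarith
  set ρ := ε / (2 * (1 + 2 * s)) with hρ
  have hρ0 : 0 < ρ := by positivity
  have hρe : ρ * (1 + 2 * s) = ε / 2 := by rw [hρ]; field_simp
  have hpn : ∀ y, ‖y - s • xb‖ ≤ ρ → ‖y - s • P y‖ ≤ ε := by
    intro y hy
    have e : y - s • P y = (y - s • xb) - s • (P y - xb) := by module
    rw [e]
    have h1 := norm_sub_le (y - s • xb) (s • (P y - xb))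
    rw [norm_smul, Real.norm_of_nonneg hs0.le] at h1
    have h2 := hdist y
    nlinarith
  have hPG : ∀ y, ‖y - s • xb‖ ≤ ρ → (P y, y - s • P y) ∈ G := by
    intro y hy
    have h2 := hdist y
    have h3 : ‖P y - xb‖ < ε := by nlinarith
    refine H2 _ _ (hP2 y) (s / 2) (ε - ‖P y - xb‖) (by linarith) fun x' hx' hd => ?_
    have := hP3 y x' (by
      have : ‖x' - xb‖ ≤ ‖x' - P y‖ + ‖P y - xb‖ := by simpa using norm_add_le (x' - P y) (P y - xb)
      linarith) hx'
    have e1 := norm_sub_sq_real x' (P y)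
    rw [real_inner_comm] at e1
    rw [inner_sub_left, real_inner_smul_left, inner_sub_right, inner_sub_right,
        real_inner_self_eq_norm_sq, e1]
    linarith
  have hmono : ∀ x p x' p', (x, p) ∈ G → (x', p') ∈ G → ‖x - xb‖ ≤ ε → ‖p‖ ≤ ε →
      ‖x' - xb‖ ≤ ε → ‖p'‖ ≤ ε → ‖x - x'‖ ≤ ‖(p + s • x) - (p' + s • x')‖ := by
    intro x p x' p' h h' hx hp hx' hp'
    have h1 := hypo D F G xb r ε H1 x p x' p' h h' hx hp hx' hp'
    have e : (p + s • x) - (p' + s • x') = (p - p') + s • (x - x') := by module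
    have h2 : ⟪(p + s • x) - (p' + s • x'), x - x'⟫ = ⟪p - p', x - x'⟫ + s * ‖x - x'‖ ^ 2 := by
      rw [e, inner_add_left, real_inner_smul_left, real_inner_self_eq_norm_sq]
    have h3 := real_inner_le_norm ((p + s • x) - (p' + s • x')) (x - x')
    by_contra hcon
    push Not at hcon
    have : 0 < ‖x - x'‖ := lt_of_le_of_lt (norm_nonneg _) hcon
    rw [hs] at h2
    rw [hs] at h3 hcon
    nlinarith
  have hρε : ρ ≤ ε := by nlinarith
  have hgraph : ∀ x p, (x, p) ∈ G → ‖x - xb‖ < ρ → ‖p‖ < ρ → ‖p + s • x - s • xb‖ ≤ ρ →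
        x = P (p + s • x) := by
    intro x p hG hx hp hy
    have := hmono x p _ _ hG (hPG _ hy) (by linarith) (by linarith) (hP1 _) (hpn _ hy)
    simp only [sub_add_cancel, sub_self, norm_zero] at this
    exact sub_eq_zero.1 (norm_eq_zero.1 (le_antisymm this (norm_nonneg _)))
  refine ⟨ρ, hρ0, P, ?_, fun y hy => ⟨hPG y hy, hP2 y, hP3 y⟩, ?_, hgraph⟩
  · have := hgraph xb 0 h0 (by simpa) (by simpa) (by simpa using hρ0.le)
    rw [zero_add] at this; exact this.symm
  · intro y y' hy hy'
    have := hmono _ _ _ _ (hPG y hy) (hPG y' hy') (hP1 _) (hpn _ hy) (hP1 _) (hpn _ hy')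
    simpa only [sub_add_cancel] using this

/-- Proximal subgradients of the scalarized resolvent give normals to the graph. -/
theorem bwd_normal (G : Set (E × E)) (xb : E) (s ρ : ℝ) (hs : 0 < s) (P : E → E)
    (hPl : ∀ y, ‖y - s • xb‖ ≤ ρ → ‖P y - xb‖ ≤ ‖y - s • xb‖)
    (hgr : ∀ x p, (x, p) ∈ G → ‖x - xb‖ < ρ → ‖p‖ < ρ → ‖p + s • x - s • xb‖ ≤ ρ →
        x = P (p + s • x)) (y v g : E) (hy : ‖y - s • xb‖ * (1 + s) < ρ) (C δ : ℝ) (hδ : 0 < δ)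
    (hsub : ∀ y', ‖y' - y‖ < δ → ⟪v, P y⟫ + ⟪g, y' - y⟫ - C * ‖y' - y‖ ^ 2 ≤ ⟪v, P y'⟫) :
    (s • g - v, g) ∈ FrechetNormalP G (P y, y - s • P y) := by
  intro e he
  have hn0 := norm_nonneg (y - s • xb)
  have hy1 : ‖y - s • xb‖ < ρ := by nlinarith
  have hPy := hPl y hy1.le
  set σ := ρ - ‖y - s • xb‖ * (1 + s) with hσ
  have hσ0 : 0 < σ := by linarith
  have hsn : 0 ≤ s * ‖y - s • xb‖ := by positivity
  refine ⟨min (min σ δ / (1 + s)) (e / ((|C| + 1) * (1 + s) ^ 2)), by positivity, ?_⟩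
  rintro ⟨x, p⟩ hG hd
  set d := dist (x, p) (P y, y - s • P y) with hdd
  have hd0 : 0 ≤ d := dist_nonneg
  have hd1 := lt_of_lt_of_le hd (min_le_left _ _)
  have hd2 := lt_of_lt_of_le hd (min_le_right _ _)
  rw [lt_div_iff₀ (by positivity)] at hd1 hd2
  have hx : ‖x - P y‖ ≤ d := by
    rw [hdd, Prod.dist_eq, ← dist_eq_norm]; exact le_max_left _ _
  have hp : ‖p - (y - s • P y)‖ ≤ d := by
    rw [hdd, Prod.dist_eq, ← dist_eq_norm]; exact le_max_right _ _
  have hdσ : d * (1 + s) < σ := lt_of_lt_of_le hd1 (min_le_left _ _)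
  have hdδ : d * (1 + s) < δ := lt_of_lt_of_le hd1 (min_le_right _ _)
  have hds : 0 ≤ d * s := by positivity
  have e1 : p + s • x - y = (p - (y - s • P y)) + s • (x - P y) := by module
  have hyd : ‖p + s • x - y‖ ≤ d * (1 + s) := by
    rw [e1]
    have := norm_add_le (p - (y - s • P y)) (s • (x - P y))
    rw [norm_smul, Real.norm_of_nonneg hs.le] at this
    nlinarith
  have hxx : x = P (p + s • x) := by
    apply hgr x p hG
    · have : ‖x - xb‖ ≤ ‖x - P y‖ + ‖P y - xb‖ := by simpa using norm_add_le (x - P y) (P y - xb)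
      linarith
    · have e2 : p = (p - (y - s • P y)) + ((y - s • xb) - s • (P y - xb)) := by module
      rw [e2]
      have h1 := norm_add_le (p - (y - s • P y)) ((y - s • xb) - s • (P y - xb))
      have h2 := norm_sub_le (y - s • xb) (s • (P y - xb))
      rw [norm_smul, Real.norm_of_nonneg hs.le] at h2
      nlinarith
    · have : ‖p + s • x - s • xb‖ ≤ ‖p + s • x - y‖ + ‖y - s • xb‖ := by
        simpa using norm_add_le (p + s • x - y) (y - s • xb)
      linarith
  have h1 := hsub (p + s • x) (by linarith)
  rw [← hxx] at h1
  have h2 : ⟪s • g - v, x - P y⟫ + ⟪g, p - (y - s • P y)⟫ =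
      ⟪g, p + s • x - y⟫ - (⟪v, x⟫ - ⟪v, P y⟫) := by
    rw [e1, inner_add_right, real_inner_smul_right, inner_sub_left, real_inner_smul_left,
      inner_sub_right v]
    ring
  show ⟪s • g - v, x - P y⟫ + ⟪g, p - (y - s • P y)⟫ ≤ e * d
  rw [h2]
  have h3 : C * ‖p + s • x - y‖ ^ 2 ≤ |C| * (d * (1 + s)) ^ 2 :=
    mul_le_mul (le_abs_self C) (by gcongr) (by positivity) (abs_nonneg C)
  have h4 : |C| * (d * (1 + s)) ^ 2 ≤ e * d := by
    have : |C| * (d * (1 + s)) ^ 2 = |C| * (1 + s) ^ 2 * d * d := by ring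
    rw [this]
    gcongr
    have : 0 ≤ d * (1 + s) ^ 2 := by positivity
    linarith
  linarith

/-- Uniform bound on proximal subgradients. -/
theorem bwd_bound [ProperSpace E] (G : Set (E × E)) (xb : E) (s ρ : ℝ) (hs : 0 < s) (hρ : 0 < ρ)
    (P : E → E) (hP0 : P (s • xb) = xb)
    (hPG : ∀ y, ‖y - s • xb‖ ≤ ρ → (P y, y - s • P y) ∈ G)
    (hPl : ∀ y y', ‖y - s • xb‖ ≤ ρ → ‖y' - s • xb‖ ≤ ρ → ‖P y - P y'‖ ≤ ‖y - y'‖)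
    (hgr : ∀ x p, (x, p) ∈ G → ‖x - xb‖ < ρ → ‖p‖ < ρ → ‖p + s • x - s • xb‖ ≤ ρ →
        x = P (p + s • x))
    (H4 : ∀ u w : E, (w, -u) ∈ LimitingNormalP G (xb, 0) → u ≠ 0 → 0 < ⟪w, u⟫) :
    ∃ ρ₁ : ℝ, 0 < ρ₁ ∧ ρ₁ ≤ ρ ∧ ∃ L : ℝ, 0 < L ∧ L * s < 1 ∧ ∀ y v g : E, ∀ C δ : ℝ, 0 < δ →
      ‖y - s • xb‖ < ρ₁ → ‖v‖ = 1 →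
      (∀ y', ‖y' - y‖ < δ → ⟪v, P y⟫ + ⟪g, y' - y⟫ - C * ‖y' - y‖ ^ 2 ≤ ⟪v, P y'⟫) → ‖g‖ < L := by
  by_contra hcon
  push Not at hcon
  have hk : ∀ k : ℕ, ∃ y v g : E, ∃ C δ : ℝ, 0 < δ ∧ ‖y - s • xb‖ < ρ / (1 + s) * (1 / ((k : ℝ) + 1)) ∧
      ‖v‖ = 1 ∧ (∀ y', ‖y' - y‖ < δ → ⟪v, P y⟫ + ⟪g, y' - y⟫ - C * ‖y' - y‖ ^ 2 ≤ ⟪v, P y'⟫) ∧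
      1 / s * (1 - 1 / ((k : ℝ) + 2)) ≤ ‖g‖ := by
    intro k
    have hk1 : 1 / ((k : ℝ) + 1) ≤ 1 := by
      rw [div_le_one (by positivity)]; linarith [k.cast_nonneg (α := ℝ)]
    have hk2 : 1 / ((k : ℝ) + 2) < 1 := by
      rw [div_lt_one (by positivity)]; linarith [k.cast_nonneg (α := ℝ)]
    have hk3 : 0 < 1 / ((k : ℝ) + 2) := by positivity
    refine hcon _ (by positivity) ?_ _ ?_ ?_
    · have : ρ / (1 + s) ≤ ρ := div_le_self hρ.le (by linarith)
      calc ρ / (1 + s) * (1 / ((k : ℝ) + 1)) ≤ ρ * 1 := by gcongr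
        _ = ρ := mul_one _
    · exact mul_pos (by positivity) (by linarith)
    · rw [mul_right_comm, one_div_mul_cancel hs.ne', one_mul]; linarith
  choose y v g C δ hδ hy hv hsub hg using hk
  have hk0 : Tendsto (fun k : ℕ => 1 / ((k : ℝ) + 1)) atTop (𝓝 0) :=
    tendsto_one_div_add_atTop_nhds_zero_nat
  have hys : ∀ k, ‖y k - s • xb‖ * (1 + s) < ρ := by
    intro k
    have hk1 : 1 / ((k : ℝ) + 1) ≤ 1 := by
      rw [div_le_one (by positivity)]; linarith [k.cast_nonneg (α := ℝ)]
    have : ‖y k - s • xb‖ < ρ / (1 + s) := lt_of_lt_of_le (hy k) (mul_le_of_le_one_right (by positivity) hk1)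
    rwa [lt_div_iff₀ (by positivity)] at this
  have hyρ : ∀ k, ‖y k - s • xb‖ < ρ := by
    intro k
    have := hys k
    have : 0 ≤ ‖y k - s • xb‖ * s := by positivity
    linarith [hys k]
  have hyt : Tendsto y atTop (𝓝 (s • xb)) := by
    rw [tendsto_iff_norm_sub_tendsto_zero]
    refine squeeze_zero (fun k => norm_nonneg _) (fun k => (hy k).le) ?_
    simpa using hk0.const_mul (ρ / (1 + s))
  have hgb : ∀ k, ‖g k‖ ≤ 1 := by
    intro k
    by_contra hc
    push Not at hc
    obtain ⟨t, ht, ht1⟩ : ∃ t : ℝ, 0 < t ∧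
        t * (‖g k‖ + |C k| * ‖g k‖ ^ 2 + 1) < min (min (δ k) (ρ - ‖y k - s • xb‖)) (‖g k‖ ^ 2 - ‖g k‖) := by
      have h1 : 0 < min (min (δ k) (ρ - ‖y k - s • xb‖)) (‖g k‖ ^ 2 - ‖g k‖) :=
        lt_min (lt_min (hδ k) (by linarith [hyρ k])) (by nlinarith)
      have h2 : 0 < ‖g k‖ + |C k| * ‖g k‖ ^ 2 + 1 := by positivity
      refine ⟨min (min (δ k) (ρ - ‖y k - s • xb‖)) (‖g k‖ ^ 2 - ‖g k‖) / 2 / (‖g k‖ + |C k| * ‖g k‖ ^ 2 + 1), by positivity, ?_⟩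
      rw [div_mul_cancel₀ _ h2.ne']; linarith
    have i1 := lt_of_lt_of_le ht1 ((min_le_left _ _).trans (min_le_left _ _))
    have i2 := lt_of_lt_of_le ht1 ((min_le_left _ _).trans (min_le_right _ _))
    have i3 := lt_of_lt_of_le ht1 (min_le_right _ _)
    have j1 : 0 ≤ t * ‖g k‖ := by positivity
    have j2 : 0 ≤ t * (|C k| * ‖g k‖ ^ 2) := by positivity
    have en : ‖(y k + t • g k) - y k‖ = t * ‖g k‖ := by
      rw [add_sub_cancel_left, norm_smul, Real.norm_of_nonneg ht.le]
    have h1 := hsub k (y k + t • g k) (by rw [en]; linarith)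
    have h2 : ‖y k + t • g k - s • xb‖ ≤ ρ := by
      have : ‖y k + t • g k - s • xb‖ ≤ ‖y k + t • g k - y k‖ + ‖y k - s • xb‖ := by
        simpa only [sub_add_sub_cancel] using norm_add_le (y k + t • g k - y k) (y k - s • xb)
      rw [en] at this
      linarith
    have h3 := hPl _ _ h2 (hyρ k).le
    rw [en] at h3 h1
    have h4 := real_inner_le_norm (v k) (P (y k + t • g k) - P (y k))
    rw [hv k, one_mul, inner_sub_right] at h4
    rw [add_sub_cancel_left, real_inner_smul_right, real_inner_self_eq_norm_sq] at h1
    have h5 : C k * (t * ‖g k‖) ^ 2 ≤ t * (t * (|C k| * ‖g k‖ ^ 2)) := by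
      have : C k * (t * ‖g k‖) ^ 2 ≤ |C k| * (t * ‖g k‖) ^ 2 := by
        gcongr; exact le_abs_self _
      linarith
    have h6 : t * ‖g k‖ ^ 2 ≤ t * (‖g k‖ + t * (|C k| * ‖g k‖ ^ 2)) := by linarith
    have h7 := le_of_mul_le_mul_left h6 ht
    linarith
  -- extract a convergent subsequence
  obtain ⟨⟨g0, v0⟩, -, φ, hφ, hlim⟩ := (isCompact_closedBall ((0 : E), (0 : E)) 1).tendsto_subseq
    (x := fun k => (g k, v k)) (by
      intro k
      rw [mem_closedBall, Prod.dist_eq]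
      simp only [dist_zero_right]
      exact max_le (hgb k) (hv k).le)
  have hg0 : Tendsto (fun k => g (φ k)) atTop (𝓝 g0) := (continuous_fst.tendsto _).comp hlim
  have hv0 : Tendsto (fun k => v (φ k)) atTop (𝓝 v0) := (continuous_snd.tendsto _).comp hlim
  have hv1 : ‖v0‖ = 1 := tendsto_nhds_unique hv0.norm (by simp [hv])
  have hg1 : 1 / s ≤ ‖g0‖ := by
    have h2 : Tendsto (fun k : ℕ => 1 / ((k : ℝ) + 2)) atTop (𝓝 0) := by
      have := (tendsto_add_atTop_iff_nat 1).2 hk0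
      refine this.congr fun k => ?_
      push_cast; ring_nf
    have h3 : Tendsto (fun k : ℕ => 1 / s * (1 - 1 / ((k : ℝ) + 2))) atTop (𝓝 (1 / s * (1 - 0))) :=
      (tendsto_const_nhds.sub h2).const_mul _
    have h4 := le_of_tendsto_of_tendsto (h3.comp hφ.tendsto_atTop) hg0.norm
      (Eventually.of_forall fun k => hg (φ k))
    simpa using h4
  have hPt : Tendsto (fun k => P (y k)) atTop (𝓝 xb) := by
    rw [tendsto_iff_norm_sub_tendsto_zero]
    rw [tendsto_iff_norm_sub_tendsto_zero] at hyt
    refine squeeze_zero (fun k => norm_nonneg _) (fun k => ?_) hyt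
    have := hPl (y k) (s • xb) (hyρ k).le (by simpa using hρ.le)
    rwa [hP0] at this
  have hN : (s • g0 - v0, - - g0) ∈ LimitingNormalP G (xb, 0) := by
    refine ⟨fun k => (P (y (φ k)), y (φ k) - s • P (y (φ k))),
      fun k => (s • g (φ k) - v (φ k), g (φ k)), fun k => ⟨hPG _ (hyρ _).le, ?_⟩, ?_, ?_⟩
    · refine bwd_normal G xb s ρ hs P (fun z hz => ?_) hgr _ _ _ (hys _) (C (φ k)) _ (hδ (φ k)) (hsub (φ k))
      have := hPl z (s • xb) hz (by simpa using hρ.le)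
      rwa [hP0] at this
    · have h1 := hPt.comp hφ.tendsto_atTop
      have h2 := (hyt.comp hφ.tendsto_atTop).sub (h1.const_smul s)
      rw [sub_self] at h2
      exact h1.prodMk_nhds h2
    · rw [neg_neg]
      exact ((hg0.const_smul s).sub hv0).prodMk_nhds hg0
  have hgpos : 0 < ‖g0‖ := lt_of_lt_of_le (by positivity) hg1
  have h1 := H4 (-g0) _ hN (by rw [neg_ne_zero]; exact norm_pos_iff.1 hgpos)
  rw [inner_neg_right, inner_sub_left, real_inner_smul_left, real_inner_self_eq_norm_sq] at h1
  have h2 := real_inner_le_norm v0 g0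
  rw [hv1] at h2
  rw [div_le_iff₀ hs] at hg1
  nlinarith
end Backward
section Final
variable {E : Type*} [NormedAddCommGroup E] [InnerProductSpace ℝ E]

/-- A mean value estimate: a bound on proximal subgradients yields a Lipschitz bound. -/
theorem bwd_lip [ProperSpace E] (P : E → E) (y0 : E) (ρ L : ℝ) (hρ : 0 < ρ) (hL0 : 0 < L)
    (hPl : ∀ y y', ‖y - y0‖ < ρ → ‖y' - y0‖ < ρ → ‖P y - P y'‖ ≤ ‖y - y'‖)
    (hb : ∀ y v g : E, ∀ C δ : ℝ, 0 < δ → ‖y - y0‖ < ρ → ‖v‖ = 1 →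
      (∀ y', ‖y' - y‖ < δ → ⟪v, P y⟫ + ⟪g, y' - y⟫ - C * ‖y' - y‖ ^ 2 ≤ ⟪v, P y'⟫) → ‖g‖ < L)
    (a b : E) (ha : ‖a - y0‖ < ρ / 8) (hb' : ‖b - y0‖ < ρ / 8) :
    ‖P a - P b‖ ≤ L * ‖a - b‖ := by
  set R := ρ / 2 with hR
  have hR0 : 0 < R := by positivity
  set M := 1 / R with hM
  have hM0 : 0 < M := by positivity
  have hMR : M * R = 1 := by rw [hM]; field_simp
  -- one-sided estimate
  have h1 : ∀ a : E, ‖a - y0‖ < ρ / 8 → ∀ v : E, ‖v‖ = 1 → ∀ y, ‖y - a‖ ≤ R →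
      ⟪v, P a⟫ ≤ ⟪v, P y⟫ + L * ‖y - a‖ + M * ‖y - a‖ ^ 2 := by
    intro a ha v hv
    have hin : ∀ y, ‖y - a‖ ≤ R → ‖y - y0‖ < ρ := by
      intro y hy
      have : ‖y - y0‖ ≤ ‖y - a‖ + ‖a - y0‖ := by simpa using norm_add_le (y - a) (a - y0)
      linarith
    have hPc : ContinuousOn P (closedBall a R) := by
      apply LipschitzOnWith.continuousOn (K := 1)
      apply LipschitzOnWith.of_dist_le_mul
      intro p hp q hq
      rw [dist_eq_norm, dist_eq_norm, NNReal.coe_one, one_mul]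
      rw [mem_closedBall, dist_eq_norm] at hp hq
      exact hPl p q (hin p hp) (hin q hq)
    have hc : ContinuousOn (fun y => ⟪v, P y⟫ + L * ‖y - a‖ + M * ‖y - a‖ ^ 2) (closedBall a R) := by
      fun_prop
    obtain ⟨z, hz, hmin⟩ := (isCompact_closedBall a R).exists_isMinOn
      ⟨a, mem_closedBall_self hR0.le⟩ hc
    rw [isMinOn_iff] at hmin
    have hza : z = a := by
      by_contra hne
      rw [mem_closedBall, dist_eq_norm] at hz
      set t := ‖z - a‖ with ht
      have ht0 : 0 < t := by rw [ht, norm_pos_iff, sub_ne_zero]; exact hne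
      have hzR : t < R := by
        have e1 := hmin a (mem_closedBall_self hR0.le)
        simp only [sub_self, norm_zero] at e1
        have e2 := hPl a z (hin a (by simpa using hR0.le)) (hin z hz)
        have e3 := real_inner_le_norm v (P a - P z)
        rw [hv, one_mul, inner_sub_right] at e3
        rw [norm_sub_rev a z] at e2
        by_contra hcon
        have : t = R := le_antisymm hz (not_lt.1 hcon)
        rw [← ht] at e2
        rw [this] at e1 e2
        have : M * R ^ 2 = R := by rw [pow_two, ← mul_assoc, hMR, one_mul]
        have : 0 < L * R := by positivity
        nlinarith
      have hgl := hb z v (-((L / t + 2 * M) • (z - a))) (L / (2 * t) + M) (R - t) (by linarith)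
        (hin z hz) hv (by
          intro y hy
          have e0 : ‖y - a‖ ≤ R := by
            have : ‖y - a‖ ≤ ‖y - z‖ + ‖z - a‖ := by simpa using norm_add_le (y - z) (z - a)
            linarith
          have e1 := hmin y (by rw [mem_closedBall, dist_eq_norm]; exact e0)
          have e2 : ‖y - a‖ ^ 2 = t ^ 2 + 2 * ⟪z - a, y - z⟫ + ‖y - z‖ ^ 2 := by
            have : y - a = (z - a) + (y - z) := by abel
            rw [this, norm_add_sq_real]
          have e3 : L * ‖y - a‖ ≤ L * t + L / (2 * t) * (‖y - a‖ ^ 2 - t ^ 2) := by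
            have : ‖y - a‖ ≤ t + (1 / (2 * t)) * (‖y - a‖ ^ 2 - t ^ 2) := by
              have h2 : 0 ≤ (1 / (2 * t)) * (‖y - a‖ - t) ^ 2 := by positivity
              have h3 : (1 / (2 * t)) * (‖y - a‖ - t) ^ 2 =
                t + (1 / (2 * t)) * (‖y - a‖ ^ 2 - t ^ 2) - ‖y - a‖ := by field_simp; ring
              linarith
            calc L * ‖y - a‖ ≤ L * (t + (1 / (2 * t)) * (‖y - a‖ ^ 2 - t ^ 2)) := by gcongr
              _ = _ := by ring
          rw [inner_neg_left, real_inner_smul_left]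
          have e4 : (L / t + 2 * M) * ⟪z - a, y - z⟫ =
              (L / (2 * t) + M) * (2 * ⟪z - a, y - z⟫) := by field_simp
          rw [e4]
          have e5 : 2 * ⟪z - a, y - z⟫ = ‖y - a‖ ^ 2 - t ^ 2 - ‖y - z‖ ^ 2 := by linarith
          rw [e5]
          linarith)
      rw [norm_neg, norm_smul, Real.norm_of_nonneg (by positivity), ← ht] at hgl
      have : (L / t + 2 * M) * t = L + 2 * M * t := by field_simp
      have : 0 < M * t := by positivity
      linarith
    intro y hy
    have := hmin y (by rw [mem_closedBall, dist_eq_norm]; exact hy)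
    rw [hza] at this
    simpa using this
  -- norm estimate, improved by bisection
  have h2 : ∀ k : ℕ, ∀ a b : E, ‖a - y0‖ < ρ / 8 → ‖b - y0‖ < ρ / 8 →
      ‖P a - P b‖ ≤ L * ‖a - b‖ + M * ‖a - b‖ ^ 2 / 2 ^ k := by
    intro k
    induction k with
    | zero =>
      intro a b ha hb
      by_cases hab : P a - P b = 0
      · rw [hab, norm_zero]; positivity
      have hn : 0 < ‖P a - P b‖ := norm_pos_iff.2 hab
      have hd : ‖b - a‖ ≤ R := by
        have : ‖b - a‖ ≤ ‖b - y0‖ + ‖a - y0‖ := by simpa using norm_sub_le (b - y0) (a - y0)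
        linarith
      have := h1 a ha ((1 / ‖P a - P b‖) • (P a - P b)) (by
        rw [norm_smul, Real.norm_of_nonneg (by positivity)]; field_simp) b hd
      have e : ⟪(1 / ‖P a - P b‖) • (P a - P b), P a - P b⟫ = ‖P a - P b‖ := by
        rw [real_inner_smul_left, real_inner_self_eq_norm_sq]; field_simp
      rw [inner_sub_right] at e
      rw [pow_zero, div_one, norm_sub_rev a b]
      linarith
    | succ k ih =>
      intro a b ha hb
      set c := (1 / 2 : ℝ) • (a + b) with hc
      have e1 : a - c = (1 / 2 : ℝ) • (a - b) := by rw [hc]; module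
      have e2 : c - b = (1 / 2 : ℝ) • (a - b) := by rw [hc]; module
      have n1 : ‖a - c‖ = 1 / 2 * ‖a - b‖ := by
        rw [e1, norm_smul, Real.norm_of_nonneg (by norm_num)]
      have n2 : ‖c - b‖ = 1 / 2 * ‖a - b‖ := by
        rw [e2, norm_smul, Real.norm_of_nonneg (by norm_num)]
      have hcn : ‖c - y0‖ < ρ / 8 := by
        have : c - y0 = (1 / 2 : ℝ) • (a - y0) + (1 / 2 : ℝ) • (b - y0) := by rw [hc]; module
        rw [this]
        have := norm_add_le ((1 / 2 : ℝ) • (a - y0)) ((1 / 2 : ℝ) • (b - y0))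
        rw [norm_smul, norm_smul, Real.norm_of_nonneg (by norm_num)] at this
        linarith
      have i1 := ih a c ha hcn
      have i2 := ih c b hcn hb
      rw [n1] at i1
      rw [n2] at i2
      have : ‖P a - P b‖ ≤ ‖P a - P c‖ + ‖P c - P b‖ := by
        simpa using norm_add_le (P a - P c) (P c - P b)
      have e : M * (1 / 2 * ‖a - b‖) ^ 2 / 2 ^ k = (M * ‖a - b‖ ^ 2 / 2 ^ (k + 1)) / 2 := by
        rw [pow_succ]; field_simp; ring
      rw [e] at i1 i2
      linarith
  have h3 : Tendsto (fun k : ℕ => L * ‖a - b‖ + M * ‖a - b‖ ^ 2 / 2 ^ k) atTop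
      (𝓝 (L * ‖a - b‖ + 0)) := by
    refine tendsto_const_nhds.add ?_
    have := (tendsto_pow_atTop_nhds_zero_of_lt_one (r := (1 / 2 : ℝ)) (by norm_num) (by norm_num)).const_mul
      (M * ‖a - b‖ ^ 2)
    rw [mul_zero] at this
    refine this.congr fun k => ?_
    rw [one_div, inv_pow]; rfl
  rw [add_zero] at h3
  exact ge_of_tendsto h3 (Eventually.of_forall fun k => h2 k a b ha hb')

theorem bwd [ProperSpace E] (D : Set E) (F : E → ℝ) (G : Set (E × E)) (xb : E) (r ε : ℝ)
    (hr : 0 < r) (hε : 0 < ε) (h0 : (xb, 0) ∈ G)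
    (H1 : ∀ x p : E, (x, p) ∈ G → ‖x - xb‖ ≤ ε → ‖p‖ ≤ ε →
      x ∈ D ∧ ∀ x', ‖x' - xb‖ ≤ ε → x' ∈ D →
        F x + ⟪p, x' - x⟫ - r / 2 * ‖x' - x‖ ^ 2 ≤ F x')
    (H2 : ∀ x p : E, x ∈ D → ∀ C δ : ℝ, 0 < δ → (∀ x', x' ∈ D → ‖x' - x‖ < δ →
      F x + ⟪p, x' - x⟫ - C * ‖x' - x‖ ^ 2 ≤ F x') → (x, p) ∈ G)
    (H3 : ∀ γ : ℝ, 0 ≤ γ → ∀ φ : E → ℝ, Continuous φ → ∃ x, ‖x - xb‖ ≤ γ ∧ x ∈ D ∧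
      ∀ x', ‖x' - xb‖ ≤ γ → x' ∈ D → F x + φ x ≤ F x' + φ x')
    (H4 : ∀ u w : E, (w, -u) ∈ LimitingNormalP G (xb, 0) → u ≠ 0 → 0 < ⟪w, u⟫) :
    ∃ γ η K : ℝ, 0 < γ ∧ 0 < η ∧ 0 < K ∧ ∃ m : E → E, m 0 = xb ∧
      (∀ p q, ‖p‖ < η → ‖q‖ < η → ‖m p - m q‖ ≤ K * ‖p - q‖) ∧
      ∀ p, ‖p‖ < η → ∀ x, x = m p ↔ (‖x - xb‖ ≤ γ ∧ x ∈ D ∧ ∀ x', ‖x' - xb‖ ≤ γ → x' ∈ D →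
        F x - ⟪p, x⟫ ≤ F x' - ⟪p, x'⟫) := by
  obtain ⟨s, hs⟩ : ∃ s, s = r + 1 := ⟨_, rfl⟩
  have hs0 : 0 < s := by linarith
  obtain ⟨ρ, hρ, P, hP0, hPm, hPl, hgr⟩ := bwd_P D F G xb r ε hr hε h0 H1 H2 H3 s hs
  obtain ⟨ρ₁, hρ₁, hρρ, L, hL, hLs, hbd⟩ := bwd_bound G xb s ρ hs0 hρ P hP0
    (fun y hy => (hPm y hy).1) hPl hgr H4
  have hlip : ∀ a b, ‖a - s • xb‖ < ρ₁ / 8 → ‖b - s • xb‖ < ρ₁ / 8 → ‖P a - P b‖ ≤ L * ‖a - b‖ :=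
    fun a b ha hb => bwd_lip P (s • xb) ρ₁ L hρ₁ hL
      (fun y y' hy hy' => hPl y y' (by linarith) (by linarith)) hbd a b ha hb
  obtain ⟨γ, hγ, hγε, hγρ⟩ : ∃ γ : ℝ, 0 < γ ∧ γ ≤ ε ∧ γ ≤ L * (ρ₁ / 8) :=
    ⟨min ε (L * (ρ₁ / 8)), by positivity, min_le_left _ _, min_le_right _ _⟩
  have hpos : 0 < 1 - L * s := by linarith
  set η := (1 - L * s) * γ / L with hη
  have hη0 : 0 < η := by positivity
  have hηL : L * η = (1 - L * s) * γ := by rw [hη]; field_simp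
  have hball : ∀ p x : E, ‖p‖ < η → ‖x - xb‖ ≤ γ → L * ‖p + s • x - s • xb‖ ≤ γ ∧
      ‖p + s • x - s • xb‖ < ρ₁ / 8 := by
    intro p x hp hx
    have e : p + s • x - s • xb = p + s • (x - xb) := by module
    have h1 := norm_add_le p (s • (x - xb))
    rw [norm_smul, Real.norm_of_nonneg hs0.le, ← e] at h1
    have h2 : s * ‖x - xb‖ ≤ s * γ := by gcongr
    have h3 : L * ‖p + s • x - s • xb‖ < L * (η + s * γ) := by
      apply mul_lt_mul_of_pos_left _ hL; linarith
    have h4 : L * (η + s * γ) = γ := by rw [mul_add, hηL]; ring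
    refine ⟨by linarith, ?_⟩
    have : L * ‖p + s • x - s • xb‖ < L * (ρ₁ / 8) := by linarith
    exact lt_of_mul_lt_mul_left this hL.le
  -- minimizers are fixed points
  have hfix : ∀ p, ‖p‖ < η → ∀ x, (‖x - xb‖ ≤ γ ∧ x ∈ D ∧ ∀ x', ‖x' - xb‖ ≤ γ → x' ∈ D →
        F x - ⟪p, x⟫ ≤ F x' - ⟪p, x'⟫) → P (p + s • x) = x := by
    rintro p hp x ⟨hx, hxD, hmin⟩
    obtain ⟨hb1, hb2⟩ := hball p x hp hx
    have hz := hPm (p + s • x) (by linarith)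
    have hzb : ‖P (p + s • x) - xb‖ ≤ γ := by
      have := hlip (p + s • x) (s • xb) hb2 (by simpa using hρ₁)
      rw [hP0] at this
      linarith
    have a1 := hz.2.2 x (by linarith) hxD
    have a2 := hmin _ hzb hz.2.1
    set z := P (p + s • x) with hzd
    have e1 := norm_sub_sq_real x z
    rw [inner_add_left, inner_add_left, real_inner_smul_left, real_inner_smul_left,
      real_inner_self_eq_norm_sq] at a1
    have : s * ‖x - z‖ ^ 2 ≤ 0 := by rw [e1]; linarith
    have h2 : ‖x - z‖ ^ 2 ≤ 0 := by
      by_contra hcon; push Not at hcon; nlinarith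
    have h3 : ‖x - z‖ = 0 := pow_eq_zero_iff two_ne_zero |>.1 (le_antisymm h2 (by positivity))
    exact (sub_eq_zero.1 (norm_eq_zero.1 h3)).symm
  have hest : ∀ p q x z, ‖p‖ < η → ‖q‖ < η → ‖x - xb‖ ≤ γ → ‖z - xb‖ ≤ γ → P (p + s • x) = x →
      P (q + s • z) = z → ‖x - z‖ ≤ L / (1 - L * s) * ‖p - q‖ := by
    intro p q x z hp hq hx hz hPx hPz
    have h1 := hlip _ _ (hball p x hp hx).2 (hball q z hq hz).2
    rw [hPx, hPz] at h1
    have e : p + s • x - (q + s • z) = (p - q) + s • (x - z) := by module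
    have h2 := norm_add_le (p - q) (s • (x - z))
    rw [norm_smul, Real.norm_of_nonneg hs0.le, ← e] at h2
    have h3 : L * ‖p + s • x - (q + s • z)‖ ≤ L * (‖p - q‖ + s * ‖x - z‖) := by gcongr
    rw [div_mul_eq_mul_div, le_div_iff₀ hpos]
    linarith
  have ex : ∀ p : E, ∃ x, ‖x - xb‖ ≤ γ ∧ x ∈ D ∧ ∀ x', ‖x' - xb‖ ≤ γ → x' ∈ D →
        F x - ⟪p, x⟫ ≤ F x' - ⟪p, x'⟫ := by
    intro p
    simpa only [sub_eq_add_neg] using H3 γ hγ.le (fun x => - ⟪p, x⟫) (by fun_prop)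
  choose m hm using ex
  refine ⟨γ, η, L / (1 - L * s), hγ, hη0, by positivity, m, ?_, ?_, ?_⟩
  · have := hest 0 0 (m 0) xb (by simpa) (by simpa) (hm 0).1 (by simpa using hγ.le)
      (hfix 0 (by simpa) _ (hm 0)) (by rw [zero_add, hP0])
    rw [sub_self, norm_zero, mul_zero] at this
    exact sub_eq_zero.1 (norm_eq_zero.1 (le_antisymm this (norm_nonneg _)))
  · intro p q hp hq
    exact hest p q _ _ hp hq (hm p).1 (hm q).1 (hfix p hp _ (hm p)) (hfix q hq _ (hm q))
  · intro p hp x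
    constructor
    · rintro rfl; exact hm p
    · intro hx
      have := hest p p x (m p) hp hp hx.1 (hm p).1 (hfix p hp _ hx) (hfix p hp _ (hm p))
      rw [sub_self, norm_zero, mul_zero] at this
      exact sub_eq_zero.1 (norm_eq_zero.1 (le_antisymm this (norm_nonneg _)))

end Final

/-- Theorem 4.6 (Poliquin–Rockafellar): tilt stability via positive-definiteness of the
generalized Hessian in finite dimensions. -/
theorem tilt_stability_iff_positive_definite_hessian (n : ℕ)
    (f : EuclideanSpace ℝ (Fin n) → EReal)
    (hproper : ∃ x, f x ≠ ⊤) (hbot : ∀ x, f x ≠ ⊥) (hlsc : LowerSemicontinuous f)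
    (xb : EuclideanSpace ℝ (Fin n))
    (h0 : (0 : EuclideanSpace ℝ (Fin n)) ∈ LimitingSubdiff f xb)
    (hpr : ProxRegularAt f xb 0) (hsc : SubdiffContAt f xb 0) :
    TiltStable f xb ↔
      ∀ u w : EuclideanSpace ℝ (Fin n), w ∈ SecondSubdiff f xb 0 u → u ≠ 0 →
        0 < ⟪w, u⟫ := by
  have hxb : f xb ≠ ⊤ := hpr.1
  obtain ⟨r, hr, ε, hε, H1⟩ := br_H1 f hbot xb hpr hsc
  constructor
  · rintro ⟨γ, hγ, V, hV, m, K, hm, hL, hm0⟩ u w hw hu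
    obtain ⟨η, hη, hηV⟩ := Metric.mem_nhds_iff.1 hV
    have hin : ∀ p, ‖p‖ < η → p ∈ V := fun p hp => hηV (by simpa using hp)
    refine fwd {x | f x ≠ ⊤} (fun x => (f x).toReal) (Gph f) xb r ε hr hε H1
      (fun x p hx C δ hδ H => br_H2 f hbot x p hx C δ hδ H) γ η (K + 1) hγ hη (by positivity) m
      (fun p hp => ?_) (fun p q hp hq => ?_) hm0 u w hw hu
    · have h1 : m p ∈ TiltArgmin f xb γ p := by rw [hm p (hin p hp)]; rfl
      exact (br_argmin f hbot xb hxb γ hγ.le p (m p)).1 h1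
    · have := hL.dist_le_mul p (hin p hp) q (hin q hq)
      rw [dist_eq_norm, dist_eq_norm] at this
      have h2 := norm_nonneg (p - q)
      linarith
  · intro H4
    obtain ⟨γ, η, K, hγ, hη, hK, m, hm0, hL, hm⟩ := bwd {x | f x ≠ ⊤} (fun x => (f x).toReal)
      (Gph f) xb r ε hr hε h0 H1
      (fun x p hx C δ hδ H => br_H2 f hbot x p hx C δ hδ H)
      (fun γ hγ φ hφ => br_H3 f hbot hlsc xb hxb γ hγ φ hφ) H4
    refine ⟨γ, hγ, Metric.ball 0 η, Metric.ball_mem_nhds _ hη, m, K.toNNReal, fun p hp => ?_, ?_, hm0⟩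
    · ext x
      rw [br_argmin f hbot xb hxb γ hγ.le p x, Set.mem_singleton_iff]
      exact (hm p (by simpa using hp) x).symm
    · apply LipschitzOnWith.of_dist_le_mul
      intro p hp q hq
      rw [dist_eq_norm, dist_eq_norm, Real.coe_toNNReal _ hK.le]
      exact hL p q (by simpa using hp) (by simpa using hq)
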